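/- arXiv:1705.10723 — 4 statements merged into one kernel-verified Lean document; each statement's English description precedes it below -/
import Mathlib

section
/- Let m, n, d be positive integers with n ≥ d, let A ∈ ℝ^{n×d} have full column rank with thin singular value decomposition A = UΣVᵀ, and let S ∈ ℝ^{m×n}. Set T = I_d − UᵀSᵀSU ∈ ℝ^{d×d}. If SA has linearly independent columns and ‖T‖₂ ≤ 1/2, then the series ∑_{k=0}^∞ Tᵏ converges and ((SA)ᵀSA)⁻¹(SA)ᵀS = VΣ⁻¹(∑_{k=0}^∞ Tᵏ)UᵀSᵀS. -/
open Matrix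

/-- Euclidean norm of a vector in `ℝ^n`. -/
noncomputable def vnorm {n : ℕ} (x : Fin n → ℝ) : ℝ := Real.sqrt (∑ i, x i ^ 2)

/-- Spectral (operator) norm of a matrix. -/
noncomputable def specNorm {m n : ℕ} (A : Matrix (Fin m) (Fin n) ℝ) : ℝ :=
  sSup {r : ℝ | ∃ x : Fin n → ℝ, vnorm x ≤ 1 ∧ r = vnorm (A.mulVec x)}

theorem vnorm_eq_norm_toLp {n : ℕ} (x : Fin n → ℝ) : vnorm x = ‖WithLp.toLp 2 x‖ := by
  simp [vnorm, EuclideanSpace.norm_eq]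

open scoped Matrix.Norms.L2Operator in
theorem l2_opNorm_le_specNorm {m n : ℕ} (A : Matrix (Fin m) (Fin n) ℝ) : ‖A‖ ≤ specNorm A := by
  have hbdd : BddAbove {r : ℝ | ∃ x : Fin n → ℝ, vnorm x ≤ 1 ∧ r = vnorm (A.mulVec x)} := by
    refine ⟨‖A‖, ?_⟩
    rintro r ⟨x, hx, rfl⟩
    rw [vnorm_eq_norm_toLp] at hx ⊢
    exact (Matrix.l2_opNorm_mulVec A (WithLp.toLp 2 x)).trans
      (mul_le_of_le_one_right (norm_nonneg _) hx)
  rw [Matrix.l2_opNorm_def]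
  refine ContinuousLinearMap.opNorm_le_of_unit_norm ?_ fun x hx => ?_
  · exact (Real.sqrt_nonneg _).trans (le_csSup hbdd ⟨0, by simp [vnorm], rfl⟩)
  · refine le_csSup hbdd ⟨x.ofLp, ?_, ?_⟩
    · rw [vnorm_eq_norm_toLp]
      exact hx.le
    · rw [vnorm_eq_norm_toLp]
      rfl

open scoped Matrix.Norms.L2Operator in
theorem summable_pow_and_one_sub_mul_tsum_pow {d : ℕ} {T : Matrix (Fin d) (Fin d) ℝ}
    (hT : specNorm T < 1) :
    Summable (fun k : ℕ => T ^ k) ∧ (1 - T) * ∑' k : ℕ, T ^ k = 1 := by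
  have h : ‖T‖ < 1 := (l2_opNorm_le_specNorm T).trans_lt hT
  exact ⟨summable_geometric_of_norm_lt_one h, mul_neg_geom_series T h⟩

/-- Claim: power-series expansion of `(SA)⁺S`. -/
theorem stmt0 (m n d : ℕ) (hm : 0 < m) (hn : 0 < n) (hd : 0 < d) (hnd : d ≤ n)
    (A : Matrix (Fin n) (Fin d) ℝ) (hrank : A.rank = d)
    (U : Matrix (Fin n) (Fin d) ℝ) (σ : Fin d → ℝ) (V : Matrix (Fin d) (Fin d) ℝ)
    (hU : Uᵀ * U = 1) (hσ : ∀ i, 0 < σ i) (hV : Vᵀ * V = 1) (hV' : V * Vᵀ = 1)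
    (hSVD : A = U * Matrix.diagonal σ * Vᵀ)
    (S : Matrix (Fin m) (Fin n) ℝ)
    (hSA : LinearIndependent ℝ (fun j : Fin d => (S * A)ᵀ j))
    (T : Matrix (Fin d) (Fin d) ℝ) (hT : T = 1 - Uᵀ * Sᵀ * S * U)
    (hTnorm : specNorm T ≤ 1 / 2) :
    Summable (fun k : ℕ => T ^ k) ∧
    ((S * A)ᵀ * (S * A))⁻¹ * (S * A)ᵀ * S =
      V * (Matrix.diagonal σ)⁻¹ * (∑' k : ℕ, T ^ k) * Uᵀ * Sᵀ * S := by
  obtain ⟨hsum, hG⟩ := summable_pow_and_one_sub_mul_tsum_pow (hTnorm.trans_lt one_half_lt_one)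
  refine ⟨hsum, ?_⟩
  generalize (∑' k : ℕ, T ^ k) = G at hG ⊢
  have hW : Uᵀ * Sᵀ * S * U = 1 - T := by rw [hT, sub_sub_cancel]
  have hdet : IsUnit (Matrix.diagonal σ).det := by
    rw [Matrix.det_diagonal]
    exact (Finset.prod_pos fun i _ => hσ i).ne'.isUnit
  set D := Matrix.diagonal σ
  have hDD : D * D⁻¹ = 1 := Matrix.mul_nonsing_inv _ hdet
  have hDD' : D⁻¹ * D = 1 := Matrix.nonsing_inv_mul _ hdet
  have hDt : Dᵀ = D := Matrix.diagonal_transpose σ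
  have hSAt : (S * A)ᵀ = V * D * Uᵀ * Sᵀ := by
    simp only [hSVD, Matrix.transpose_mul, Matrix.transpose_transpose, hDt, Matrix.mul_assoc]
  have hgram : (S * A)ᵀ * (S * A) = V * D * (1 - T) * D * Vᵀ := by
    rw [hSAt, hSVD, ← hW]
    simp only [Matrix.mul_assoc]
  have hinv : ((S * A)ᵀ * (S * A))⁻¹ = V * D⁻¹ * G * D⁻¹ * Vᵀ := by
    refine Matrix.inv_eq_right_inv ?_
    calc (S * A)ᵀ * (S * A) * (V * D⁻¹ * G * D⁻¹ * Vᵀ)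
        = V * D * (1 - T) * (D * (Vᵀ * V) * D⁻¹) * G * D⁻¹ * Vᵀ := by
          rw [hgram]
          simp only [Matrix.mul_assoc]
      _ = V * (D * ((1 - T) * G) * D⁻¹) * Vᵀ := by
          rw [hV, Matrix.mul_one, hDD, Matrix.mul_one]
          simp only [Matrix.mul_assoc]
      _ = 1 := by rw [hG, Matrix.mul_one, hDD, Matrix.mul_one, hV']
  calc ((S * A)ᵀ * (S * A))⁻¹ * (S * A)ᵀ * S
      = V * D⁻¹ * G * (D⁻¹ * (Vᵀ * V) * D) * Uᵀ * Sᵀ * S := by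
        rw [hinv, hSAt]
        simp only [Matrix.mul_assoc]
    _ = V * D⁻¹ * G * Uᵀ * Sᵀ * S := by rw [hV, Matrix.mul_one, hDD', Matrix.mul_one]
end

section
/- For every constant c₀ > 0 there exists a constant C > 0 such that the following holds. Let n ≥ 2, r ≥ 1, d ≥ 1, k ≥ 1 be integers, let S ∈ ℝ^{r×n} be a (deterministic) matrix whose columns S_1, …, S_n satisfy ‖S_i‖₂ = 1 for all i and ⟨S_i, S_j⟩² ≤ c₀·(log n)/r for all i ≠ j, let U ∈ ℝ^{n×d} have orthonormal columns, let a ∈ ℝ^n be a unit vector, and let b ∈ ℝ^n. Define Q = ∑ a_{i₀}²·b_{j_k}²·(∏_{c=0}^{k} ⟨S_{i_c}, S_{j_c}⟩²)·(∏_{c=1}^{k} (UUᵀ)_{j_{c−1}, i_c}²), where the sum ranges over all indices i₀, i₁, …, i_k, j₀, j₁, …, j_k ∈ [n] with i_k ≠ j_k. Then Q ≤ (C·d·(log n)/r + 1)^{k−1}·(C·d·‖b‖₂²·(log n)²/r² + C·‖b‖₂²·(log n)/r). -/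
open Matrix

open Finset

/-- Summing over tuples of length `k + 1` by splitting off the first entry. -/
lemma sum_fin_cons {ι : Type*} [Fintype ι] {k : ℕ} (f : (Fin (k + 1) → ι) → ℝ) :
    ∑ p, f p = ∑ x, ∑ p : Fin k → ι, f (Fin.cons x p) := by
  rw [← (Fin.consEquiv (fun _ : Fin (k + 1) => ι)).sum_comp, Fintype.sum_prod_type]
  rfl

/-- A weighted sum over alternating paths with kernels `M` and `P` whose last `M`-step is
off-diagonal. -/
lemma sum_paths_le {ι : Type*} [Fintype ι] [DecidableEq ι] {M P : ι → ι → ℝ} {β : ι → ℝ}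
    {ε t : ℝ} (hM : ∀ x y, 0 ≤ M x y) (hP : ∀ x y, 0 ≤ P x y) (hβ : ∀ x, 0 ≤ β x) (hε : 0 ≤ ε)
    (ht : 0 ≤ t) (hMε : ∀ x y, x ≠ y → M x y ≤ ε)
    (hrow : ∀ x, ∑ y, M x y * ∑ z, P y z ≤ t) (k : ℕ) :
    ∀ α : ι → ℝ, (∀ x, 0 ≤ α x) →
      ∑ p : Fin (k + 1) → ι, ∑ q : Fin (k + 1) → ι,
        (if p (Fin.last k) ≠ q (Fin.last k) then
          α (p 0) * β (q (Fin.last k)) * (∏ c, M (p c) (q c)) *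
            ∏ c : Fin k, P (q c.castSucc) (p c.succ) else 0) ≤
      ε * (∑ x, β x) * t ^ k * ∑ x, α x := by
  induction k with
  | zero =>
    intro α hα
    simp only [sum_fin_cons, Fintype.sum_unique]
    simp only [Fin.last_zero, Fin.cons_zero, Fin.prod_univ_succ, univ_eq_empty, prod_empty, mul_one,
      pow_zero]
    rw [mul_sum]
    refine sum_le_sum fun x _ => ?_
    rw [mul_sum, sum_mul]
    refine sum_le_sum fun y _ => ?_
    split_ifs with h
    · calc α x * β y * M x y ≤ α x * β y * ε :=
            mul_le_mul_of_nonneg_left (hMε x y h) (mul_nonneg (hα x) (hβ y))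
        _ = ε * β y * α x := by ring
    · exact mul_nonneg (mul_nonneg hε (hβ y)) (hα x)
  | succ k ih =>
    intro α hα
    have hα' : ∀ z, 0 ≤ ∑ x, ∑ y, α x * M x y * P y z := fun z =>
      sum_nonneg fun x _ => sum_nonneg fun y _ =>
        mul_nonneg (mul_nonneg (hα x) (hM x y)) (hP y z)
    have hsum : ∑ z, ∑ x, ∑ y, α x * M x y * P y z ≤ t * ∑ x, α x := by
      rw [sum_comm, mul_sum]
      refine sum_le_sum fun x _ => ?_
      rw [sum_comm]
      calc ∑ y, ∑ z, α x * M x y * P y z = α x * ∑ y, M x y * ∑ z, P y z := by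
            simp only [mul_sum, mul_assoc]
        _ ≤ α x * t := mul_le_mul_of_nonneg_left (hrow x) (hα x)
        _ = t * α x := mul_comm _ _
    have hB : 0 ≤ ε * (∑ x, β x) * t ^ k :=
      mul_nonneg (mul_nonneg hε (sum_nonneg fun x _ => hβ x)) (pow_nonneg ht k)
    refine le_trans (le_of_eq ?_) ((ih _ hα').trans ((mul_le_mul_of_nonneg_left hsum hB).trans
      (le_of_eq (by ring))))
    rw [sum_fin_cons, sum_comm]
    refine sum_congr rfl fun p _ => ?_
    simp only [sum_fin_cons (k := k + 1)]
    rw [sum_congr rfl fun x _ => sum_comm, sum_comm]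
    refine sum_congr rfl fun q _ => ?_
    simp only [← Fin.succ_last, Fin.cons_succ]
    split_ifs with h
    · simp only [sum_mul]
      refine sum_congr rfl fun x _ => sum_congr rfl fun y _ => ?_
      rw [Fin.prod_univ_succ (n := k + 1),
        Fin.prod_univ_succ fun c : Fin (k + 1) => P (Fin.cons (α := fun _ => ι) y q c.castSucc) _]
      simp only [Fin.cons_zero, Fin.cons_succ, Fin.castSucc_zero, Fin.castSucc_succ]
      ring
    · simp

/-- The squared entries in a row of an orthogonal projection sum to the diagonal entry. -/
lemma sum_sq_mul_transpose_row {n d : ℕ} {U : Matrix (Fin n) (Fin d) ℝ} (hU : Uᵀ * U = 1)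
    (y : Fin n) : ∑ z, (U * Uᵀ) y z ^ 2 = (U * Uᵀ) y y := by
  have hidem : (U * Uᵀ) * (U * Uᵀ)ᵀ = U * Uᵀ := by
    rw [transpose_mul, transpose_transpose, Matrix.mul_assoc, ← Matrix.mul_assoc Uᵀ, hU,
      Matrix.one_mul]
  conv_rhs => rw [← hidem, Matrix.mul_apply]
  exact sum_congr rfl fun z _ => by rw [transpose_apply, sq]

lemma mul_transpose_diag_le_one {n d : ℕ} {U : Matrix (Fin n) (Fin d) ℝ} (hU : Uᵀ * U = 1)
    (y : Fin n) : (U * Uᵀ) y y ≤ 1 := by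
  have h := single_le_sum (f := fun z => (U * Uᵀ) y z ^ 2) (fun z _ => sq_nonneg _) (mem_univ y)
  rw [sum_sq_mul_transpose_row hU] at h
  nlinarith

lemma sum_mul_transpose_diag {n d : ℕ} {U : Matrix (Fin n) (Fin d) ℝ} (hU : Uᵀ * U = 1) :
    ∑ y, (U * Uᵀ) y y = d := by
  change trace (U * Uᵀ) = d
  rw [trace_mul_comm, hU, trace_one, Fintype.card_fin]

lemma vnorm_sq {n : ℕ} (x : Fin n → ℝ) : vnorm x ^ 2 = ∑ i, x i ^ 2 :=
  Real.sq_sqrt (sum_nonneg fun _ _ => sq_nonneg _)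

/-- bounding `E‖Z‖_F²` for matrices with unit columns and small pairwise
column inner products. -/
theorem stmt5 :
    ∀ c₀ : ℝ, 0 < c₀ →
    ∃ C : ℝ, 0 < C ∧
    ∀ (n r d k : ℕ), 2 ≤ n → 1 ≤ r → 1 ≤ d → 1 ≤ k →
    ∀ (S : Matrix (Fin r) (Fin n) ℝ),
      (∀ i : Fin n, vnorm (fun t => S t i) = 1) →
      (∀ i j : Fin n, i ≠ j →
        ((fun t => S t i) ⬝ᵥ (fun t => S t j)) ^ 2 ≤ c₀ * Real.log n / r) →
    ∀ (U : Matrix (Fin n) (Fin d) ℝ), Uᵀ * U = 1 →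
    ∀ (a : Fin n → ℝ), vnorm a = 1 →
    ∀ (b : Fin n → ℝ),
      (∑ q ∈ Finset.univ.filter
          (fun q : (Fin (k + 1) → Fin n) × (Fin (k + 1) → Fin n) =>
            q.1 (Fin.last k) ≠ q.2 (Fin.last k)),
        a (q.1 0) ^ 2 * b (q.2 (Fin.last k)) ^ 2 *
          (∏ c : Fin (k + 1), ((fun t => S t (q.1 c)) ⬝ᵥ (fun t => S t (q.2 c))) ^ 2) *
          (∏ c : Fin k, ((U * Uᵀ) (q.2 c.castSucc) (q.1 c.succ)) ^ 2)) ≤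
      (C * d * Real.log n / r + 1) ^ (k - 1) *
        (C * d * vnorm b ^ 2 * Real.log n ^ 2 / r ^ 2 + C * vnorm b ^ 2 * Real.log n / r) := by
  intro c₀ hc₀
  refine ⟨c₀ + c₀ ^ 2, by positivity, ?_⟩
  intro n r d k hn hr hd hk S hS hSS U hU a ha b
  obtain ⟨m, rfl⟩ : ∃ m, k = m + 1 := ⟨k - 1, by omega⟩
  have hL : 0 ≤ Real.log n := Real.log_natCast_nonneg n
  have hε : 0 ≤ c₀ * Real.log n / r := by positivity
  have hdiag : ∀ x : Fin n, ((fun t => S t x) ⬝ᵥ (fun t => S t x)) ^ 2 = 1 := fun x => by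
    have h := vnorm_sq fun t => S t x
    rw [hS x] at h
    have h' : (fun t => S t x) ⬝ᵥ (fun t => S t x) = 1 := by
      simp only [dotProduct, ← sq]
      linarith
    rw [h', one_pow]
  have hnn : ∀ y, 0 ≤ (U * Uᵀ) y y := fun y => by
    rw [← sum_sq_mul_transpose_row hU]
    exact sum_nonneg fun _ _ => sq_nonneg _
  have hrow : ∀ x, ∑ y, ((fun t => S t x) ⬝ᵥ (fun t => S t y)) ^ 2 * ∑ z, (U * Uᵀ) y z ^ 2 ≤
      c₀ * Real.log n / r * d + 1 := fun x => by
    simp only [sum_sq_mul_transpose_row hU]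
    calc _ ≤ ∑ y, (c₀ * Real.log n / r * (U * Uᵀ) y y + if y = x then (U * Uᵀ) y y else 0) := by
          refine sum_le_sum fun y _ => ?_
          split_ifs with h
          · subst h
            rw [hdiag, one_mul]
            exact le_add_of_nonneg_left (mul_nonneg hε (hnn y))
          · rw [add_zero]
            exact mul_le_mul_of_nonneg_right (hSS x y (Ne.symm h)) (hnn y)
      _ = c₀ * Real.log n / r * d + (U * Uᵀ) x x := by
          rw [sum_add_distrib, ← mul_sum, sum_mul_transpose_diag hU, sum_ite_eq' univ x]
          simp
      _ ≤ _ := by gcongr; exact mul_transpose_diag_le_one hU x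
  have key := sum_paths_le (M := fun x y => ((fun t => S t x) ⬝ᵥ (fun t => S t y)) ^ 2)
    (P := fun x y => (U * Uᵀ) x y ^ 2) (β := fun x => b x ^ 2) (t := c₀ * Real.log n / r * d + 1)
    (fun _ _ => sq_nonneg _) (fun _ _ => sq_nonneg _) (fun _ => sq_nonneg _) hε (by positivity)
    hSS hrow (m + 1) (fun x => a x ^ 2) (fun _ => sq_nonneg _)
  rw [← vnorm_sq a, ha, ← vnorm_sq b] at key
  rw [sum_filter, Fintype.sum_prod_type]
  refine key.trans ?_
  rw [Nat.add_sub_cancel]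
  calc c₀ * Real.log n / r * vnorm b ^ 2 * (c₀ * Real.log n / r * d + 1) ^ (m + 1) * 1 ^ 2
      = (c₀ * d * Real.log n / r + 1) ^ m * (c₀ ^ 2 * d * vnorm b ^ 2 * Real.log n ^ 2 / r ^ 2 +
          c₀ * vnorm b ^ 2 * Real.log n / r) := by
        rw [show c₀ * Real.log n / r * d + 1 = c₀ * d * Real.log n / r + 1 by ring]
        ring
    _ ≤ _ := by
        have h₁ : c₀ ≤ c₀ + c₀ ^ 2 := le_add_of_nonneg_right (sq_nonneg _)
        have h₂ : c₀ ^ 2 ≤ c₀ + c₀ ^ 2 := le_add_of_nonneg_left hc₀.le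
        gcongr
end

section
/- Let d, s, m, α, n be positive integers with n ≥ d + α, let A ∈ ℝ^{n×d} have the d×d identity matrix as its top d rows and zeros elsewhere, and let b ∈ ℝ^n have b_i = 1/√d for 1 ≤ i ≤ d, b_i = 1/√α for d+1 ≤ i ≤ d+α, and b_i = 0 otherwise. Let S ∈ ℝ^{m×n} be any matrix in which every column has exactly s nonzero entries, each equal to +1/√s or −1/√s. Suppose j ∈ [d] is an index such that supp(S_j) ∩ supp(S_{k'}) = ∅ for every k' ∈ [d+α] with k' ≠ j, except for exactly one k ∈ {d+1, …, d+α}, for which |supp(S_j) ∩ supp(S_k)| = 1. Then every minimizer x' of ‖SAx − Sb‖₂ over x ∈ ℝ^d satisfies |x'_j − 1/√d| = 1/(s·√α). In particular, since the least-squares solution x* = Aᵀb of min_x ‖Ax − b‖₂ has x*_j = 1/√d, every such x' satisfies ‖x' − x*‖_∞ ≥ 1/(s·√α). -/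
open Matrix

/-- ℓ∞ norm of a vector in `ℝ^n`. -/
noncomputable def vnormInf {n : ℕ} (x : Fin n → ℝ) : ℝ := ⨆ i, |x i|

/-- The support of the `j`-th column of a matrix `S`. -/
noncomputable def colSupp {m n : ℕ} (S : Matrix (Fin m) (Fin n) ℝ) (j : Fin n) :
    Finset (Fin m) :=
  Finset.univ.filter (fun i => S i j ≠ 0)

/-- A minimizer of a least-squares objective satisfies the normal equations. -/
theorem sum_mul_residual_eq_zero {m d : ℕ} (M : Matrix (Fin m) (Fin d) ℝ) (c : Fin m → ℝ)
    (x : Fin d → ℝ)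
    (hx : ∀ z : Fin d → ℝ, vnorm (M.mulVec x - c) ≤ vnorm (M.mulVec z - c)) (l : Fin d) :
    ∑ i, M i l * (M.mulVec x - c) i = 0 := by
  set r := M.mulVec x - c with hr
  set P := ∑ i, M i l * r i with hP
  set Q := ∑ i, M i l ^ 2 with hQ
  have hQ0 : 0 ≤ Q := Finset.sum_nonneg fun i _ => sq_nonneg _
  have key : ∀ t : ℝ, 0 ≤ 2 * t * P + t ^ 2 * Q := by
    intro t
    have h := hx (x + Pi.single l t)
    unfold vnorm at h
    rw [Real.sqrt_le_sqrt_iff (Finset.sum_nonneg fun i _ => sq_nonneg _)] at h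
    have h2 : ∑ i, (M.mulVec (x + Pi.single l t) - c) i ^ 2
        = ∑ i, r i ^ 2 + (2 * t * P + t ^ 2 * Q) := by
      rw [hP, hQ, Finset.mul_sum, Finset.mul_sum, ← Finset.sum_add_distrib,
        ← Finset.sum_add_distrib]
      refine Finset.sum_congr rfl fun i _ => ?_
      simp only [hr, Matrix.mulVec_add, Pi.sub_apply, Pi.add_apply, Matrix.mulVec_single,
        Pi.smul_apply, Matrix.col_apply, MulOpposite.smul_eq_mul_unop, MulOpposite.unop_op]
      ring
    rw [h2] at h
    linarith
  have h := key (-P / (Q + 1))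
  have h3 : 2 * (-P / (Q + 1)) * P + (-P / (Q + 1)) ^ 2 * Q
      = -(P ^ 2 * (Q + 2)) / (Q + 1) ^ 2 := by
    field_simp
    ring
  rw [h3] at h
  have h4 : 0 < (Q + 1) ^ 2 := by positivity
  rw [le_div_iff₀ h4, zero_mul] at h
  have h5 : P ^ 2 ≤ 0 := by nlinarith [mul_nonneg (sq_nonneg P) hQ0]
  exact pow_eq_zero_iff two_ne_zero |>.1 (le_antisymm h5 (sq_nonneg P))

theorem sum_col_mul_col_eq_sum_inter {m n : ℕ} (S : Matrix (Fin m) (Fin n) ℝ) (j k : Fin n) :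
    ∑ i, S i j * S i k = ∑ i ∈ colSupp S j ∩ colSupp S k, S i j * S i k := by
  symm
  refine Finset.sum_subset (Finset.subset_univ _) fun i _ hi => ?_
  simpa [colSupp, or_iff_not_imp_left] using hi

/-- the explicit error of sketch-and-solve on the hard instance, for a
column of `S` whose support meets the other relevant columns' supports in exactly one entry
of exactly one column. -/
theorem stmt13 (d s m α n : ℕ) (hd : 0 < d) (hs : 0 < s) (hm : 0 < m) (hα : 0 < α)
    (hn : d + α ≤ n)
    (A : Matrix (Fin n) (Fin d) ℝ)
    (hA : A = Matrix.of (fun (i : Fin n) (j : Fin d) => if (i : ℕ) = (j : ℕ) then (1 : ℝ) else 0))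
    (b : Fin n → ℝ)
    (hb : b = fun (i : Fin n) => if (i : ℕ) < d then 1 / Real.sqrt d
      else if (i : ℕ) < d + α then 1 / Real.sqrt α else 0)
    (S : Matrix (Fin m) (Fin n) ℝ)
    (hScol : ∀ j : Fin n, (colSupp S j).card = s)
    (hSval : ∀ (i : Fin m) (j : Fin n),
      S i j = 0 ∨ S i j = 1 / Real.sqrt s ∨ S i j = -(1 / Real.sqrt s))
    (j : Fin n) (hj : (j : ℕ) < d)
    (k : Fin n) (hk₁ : d ≤ (k : ℕ)) (hk₂ : (k : ℕ) < d + α)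
    (hjk : (colSupp S j ∩ colSupp S k).card = 1)
    (hdisj : ∀ k' : Fin n, (k' : ℕ) < d + α → k' ≠ j → k' ≠ k →
      colSupp S j ∩ colSupp S k' = ∅) :
    ∀ x' : Fin d → ℝ,
      (∀ z : Fin d → ℝ,
        vnorm ((S * A).mulVec x' - S.mulVec b) ≤ vnorm ((S * A).mulVec z - S.mulVec b)) →
      |x' ⟨(j : ℕ), hj⟩ - 1 / Real.sqrt d| = 1 / (s * Real.sqrt α) ∧
      1 / (s * Real.sqrt α) ≤ vnormInf (x' - Aᵀ.mulVec b) := by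
  intro x' hx'
  have hs' : (0 : ℝ) < s := Nat.cast_pos.2 hs
  have hα' : (0 : ℝ) < α := Nat.cast_pos.2 hα
  have abs_entry : ∀ i l, S i l ≠ 0 → |S i l| = 1 / Real.sqrt s := by
    intro i l h
    have h0 : (0 : ℝ) ≤ 1 / Real.sqrt s := by positivity
    rcases hSval i l with h1 | h1 | h1
    · exact absurd h1 h
    · rw [h1, abs_of_nonneg h0]
    · rw [h1, abs_neg, abs_of_nonneg h0]
  have sq_inv : (1 / Real.sqrt s) * (1 / Real.sqrt s) = 1 / (s : ℝ) := by
    rw [div_mul_div_comm, Real.mul_self_sqrt hs'.le, one_mul]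
  have gram_self : ∑ i, S i j * S i j = 1 := by
    rw [sum_col_mul_col_eq_sum_inter, Finset.inter_self]
    have : ∀ i ∈ colSupp S j, S i j * S i j = 1 / (s : ℝ) := by
      intro i hi
      rw [← abs_mul_abs_self, abs_entry i j (by simpa [colSupp] using hi), sq_inv]
    rw [Finset.sum_congr rfl this, Finset.sum_const, hScol, nsmul_eq_mul]
    field_simp
  have gram_k : |∑ i, S i j * S i k| = 1 / (s : ℝ) := by
    rw [sum_col_mul_col_eq_sum_inter]
    obtain ⟨i, hi⟩ := Finset.card_eq_one.1 hjk
    have hmem : i ∈ colSupp S j ∩ colSupp S k := by simp [hi]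
    simp only [colSupp, Finset.mem_inter, Finset.mem_filter, Finset.mem_univ, true_and] at hmem
    rw [hi, Finset.sum_singleton, abs_mul, abs_entry i j hmem.1, abs_entry i k hmem.2, sq_inv]
  set y : Fin n → ℝ := A.mulVec x' - b with hy
  have hres : (S * A).mulVec x' - S.mulVec b = S.mulVec y := by
    rw [hy, Matrix.mulVec_sub, Matrix.mulVec_mulVec]
  have hcol : ∀ i, (S * A) i ⟨j, hj⟩ = S i j := by
    intro i
    simp [Matrix.mul_apply, hA, ← Fin.ext_iff]
  have hyj : y j = x' ⟨j, hj⟩ - 1 / Real.sqrt d := by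
    have : ∀ l : Fin d, (j : ℕ) = l ↔ (⟨j, hj⟩ : Fin d) = l := fun l => by simp [Fin.ext_iff]
    simp [hy, hA, hb, hj, Matrix.mulVec, dotProduct, this]
  have hAzero : ∀ i : Fin n, d ≤ (i : ℕ) → A.mulVec x' i = 0 := by
    intro i hi
    rw [Matrix.mulVec, dotProduct]
    refine Finset.sum_eq_zero fun l _ => ?_
    have : (i : ℕ) ≠ l := by omega
    simp [hA, this]
  have hyk : y k = -(1 / Real.sqrt α) := by
    have : ¬ (k : ℕ) < d := by omega
    simp [hy, hAzero k hk₁, hb, this, hk₂]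
  have hytail : ∀ i : Fin n, d + α ≤ (i : ℕ) → y i = 0 := by
    intro i hi
    have h1 : ¬ (i : ℕ) < d := by omega
    have h2 : ¬ (i : ℕ) < d + α := by omega
    simp [hy, hAzero i (by omega), hb, h1, h2]
  have hne : j ≠ k := by
    rintro rfl
    omega
  have hnormal : y j + (∑ i, S i j * S i k) * y k = 0 := by
    have h := sum_mul_residual_eq_zero (S * A) (S.mulVec b) x' hx' ⟨j, hj⟩
    rw [hres] at h
    have hswap : ∑ i, (S * A) i ⟨j, hj⟩ * S.mulVec y i
        = ∑ l, (∑ i, S i j * S i l) * y l := by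
      simp only [hcol, Matrix.mulVec, dotProduct, Finset.mul_sum, Finset.sum_mul]
      rw [Finset.sum_comm]
      simp only [mul_assoc]
    rw [hswap, Finset.sum_eq_add j k hne] at h
    · rwa [gram_self, one_mul] at h
    · rintro l - ⟨hlj, hlk⟩
      by_cases hl : (l : ℕ) < d + α
      · rw [sum_col_mul_col_eq_sum_inter, hdisj l hl hlj hlk, Finset.sum_empty, zero_mul]
      · rw [hytail l (not_lt.1 hl), mul_zero]
    · simp
    · simp
  have herr : |x' ⟨j, hj⟩ - 1 / Real.sqrt d| = 1 / (s * Real.sqrt α) := by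
    rw [← hyj, eq_neg_of_add_eq_zero_left hnormal, abs_neg, abs_mul, gram_k, hyk, abs_neg,
      abs_of_nonneg (by positivity), div_mul_div_comm, one_mul]
  refine ⟨herr, ?_⟩
  have hstar : Aᵀ.mulVec b ⟨j, hj⟩ = 1 / Real.sqrt d := by
    have : b j = 1 / Real.sqrt d := by simp [hb, hj]
    simp [Matrix.mulVec, dotProduct, hA, ← Fin.ext_iff, this]
  rw [← herr, ← hstar]
  exact le_ciSup (f := fun i => |(x' - Aᵀ.mulVec b) i|) (Set.finite_range _).bddAbove ⟨j, hj⟩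
end

section
/- Let d ≥ 2, α ≥ 1, and β be integers with 1 ≤ β < d, let L = α·(d−1) and n = d + L·d. Let A ∈ ℝ^{n×d} consist of the block (1/√d)·I_d in its top d rows, followed by L blocks each equal to (1/√(αd))·I_d; then A has orthonormal columns, and its leverage scores are l_i = 1/d for 1 ≤ i ≤ d and l_i = 1/(αd) for d < i ≤ n. Let b ∈ ℝ^n have b_i = 1/√d for 1 ≤ i ≤ d, b_{d+i} = 1/√β for 1 ≤ i ≤ β, and all other entries 0, and let x* = Aᵀb be the least-squares solution of min_x ‖Ax − b‖₂; then x*_j = 1/d + 1/√(αβd) for 1 ≤ j ≤ β and x*_j = 1/d for β < j ≤ d, and ‖Ax* − b‖₂ ≤ √2 and ‖b‖₂ = √2. Let D ∈ ℝ^{n×n} be any diagonal matrix with D_{ii} ∈ {0, 1/√(l_i)} for every i, such that D_{ii} ≠ 0 for all 1 ≤ i ≤ d. Suppose there exists j with 1 ≤ j ≤ β such that D_{d+j, d+j} = 0, and let t = #{c ∈ [L] : D_{d+(c−1)d+j, d+(c−1)d+j} ≠ 0}. Then the unique minimizer x' of ‖DAx − Db‖₂ satisfies x'_j = 1/(1+t),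 and consequently ‖x' − x*‖_∞ ≥ 1/(1+t) − 1/d − 1/√(αβd). -/
open Matrix

/-- A sum over `ι` may be computed fibre by fibre along `col`. -/
theorem sum_eq_sum_fiber {ι κ : Type*} [Fintype ι] [Fintype κ] [DecidableEq κ]
    (col : ι → κ) (g : ι → κ → ℝ) :
    ∑ i, g i (col i) = ∑ k, ∑ i, (if col i = k then g i k else 0) := by
  rw [Finset.sum_comm]
  simp

/-- Pythagorean identity for a least-squares problem in which each row involves exactly one
coordinate: `p` solves the normal equations. -/
theorem sum_sq_residual_eq {ι κ : Type*} [Fintype ι] [Fintype κ] [DecidableEq κ]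
    (col : ι → κ) (w v : ι → ℝ) (p : κ → ℝ)
    (hp : ∀ k, p k * ∑ i, (if col i = k then w i ^ 2 else 0) =
      ∑ i, if col i = k then w i * v i else 0) (z : κ → ℝ) :
    ∑ i, (w i * z (col i) - v i) ^ 2 = ∑ i, (w i * p (col i) - v i) ^ 2 +
      ∑ k, (∑ i, if col i = k then w i ^ 2 else 0) * (z k - p k) ^ 2 := by
  rw [sum_eq_sum_fiber col fun i k => (w i * z k - v i) ^ 2,
    sum_eq_sum_fiber col fun i k => (w i * p k - v i) ^ 2, ← Finset.sum_add_distrib]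
  refine Finset.sum_congr rfl fun k _ => ?_
  have key : (∑ i, if col i = k then (w i * z k - v i) ^ 2 else 0) =
      (∑ i, if col i = k then (w i * p k - v i) ^ 2 else 0) +
      (∑ i, if col i = k then w i ^ 2 else 0) * (z k - p k) ^ 2 +
      2 * (z k - p k) * (p k * (∑ i, if col i = k then w i ^ 2 else 0) -
        ∑ i, if col i = k then w i * v i else 0) := by
    simp only [mul_sub, Finset.sum_mul, Finset.mul_sum, ← Finset.sum_add_distrib,
      ← Finset.sum_sub_distrib]
    refine Finset.sum_congr rfl fun i _ => ?_
    split_ifs <;> ring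
  rw [key, hp k]
  ring

theorem sum_fin_mod_eq {d j : ℕ} (hj : j < d) (L : ℕ) {n : ℕ} (hn : n = d + L * d) (f : ℕ → ℝ) :
    ∑ i : Fin n, (if (i : ℕ) % d = j then f i else 0) =
      ∑ c ∈ Finset.range (L + 1), f (c * d + j) := by
  rw [Fin.sum_univ_eq_sum_range (fun i => if i % d = j then f i else 0),
    show n = (L + 1) * d by rw [hn]; ring]
  generalize L + 1 = m
  induction m with
  | zero => simp
  | succ m ih =>
    rw [add_mul, one_mul, Finset.sum_range_add, ih, Finset.sum_range_succ]
    congr 1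
    rw [Finset.sum_eq_single_of_mem j (Finset.mem_range.2 hj)]
    · simp [Nat.mod_eq_of_lt hj]
    · intro x hx hxj
      rw [Finset.mem_range] at hx
      simp [Nat.mod_eq_of_lt hx, hxj]

theorem exists_eq_mul_add_iff {d j L i : ℕ} (hj : j < d) (hi : i < d + L * d) :
    (∃ c, 1 ≤ c ∧ c ≤ L ∧ i = c * d + j) ↔ i % d = j ∧ i ≠ j := by
  constructor
  · rintro ⟨c, hc, -, rfl⟩
    have := Nat.mul_le_mul_right d hc
    exact ⟨by rw [Nat.mul_add_mod', Nat.mod_eq_of_lt hj], by lia⟩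
  · rintro ⟨hij, hne⟩
    have hdm : i / d * d + j = i := by
      rw [← hij, Nat.div_add_mod']
    refine ⟨i / d, ?_, ?_, hdm.symm⟩
    · by_contra! h
      rw [Nat.lt_one_iff.1 h, zero_mul, zero_add] at hdm
      exact hne hdm.symm
    · rw [← Nat.lt_succ_iff, Nat.div_lt_iff_lt_mul (by lia), Nat.succ_mul]
      lia

theorem vnorm_le_vnorm_iff {n : ℕ} (x y : Fin n → ℝ) :
    vnorm x ≤ vnorm y ↔ ∑ i, x i ^ 2 ≤ ∑ i, y i ^ 2 :=
  Real.sqrt_le_sqrt_iff (Finset.sum_nonneg fun _ _ => sq_nonneg _)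

set_option maxHeartbeats 400000 in
/-- leverage score sampling does not obey the ℓ∞ guarantee on the hard
instance: if the sampling matrix `D` drops the row `d+j` (the unique row pairing coordinate
`j` with the `1/√β` part of `b`), then the sketched solution has `x'_j = 1/(1+t)`. -/
theorem stmt14 (d α β : ℕ) (hd : 2 ≤ d) (hα : 1 ≤ α) (hβ₁ : 1 ≤ β) (hβd : β < d)
    (L n : ℕ) (hL : L = α * (d - 1)) (hn : n = d + L * d)
    (A : Matrix (Fin n) (Fin d) ℝ)
    (hA : A = Matrix.of (fun (i : Fin n) (j : Fin d) =>
      if (i : ℕ) % d = (j : ℕ) then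
        (if (i : ℕ) < d then 1 / Real.sqrt d else 1 / Real.sqrt ((α : ℝ) * d)) else 0))
    (b : Fin n → ℝ)
    (hb : b = fun (i : Fin n) => if (i : ℕ) < d then 1 / Real.sqrt d
      else if (i : ℕ) < d + β then 1 / Real.sqrt β else 0)
    (xstar : Fin d → ℝ) (hxstar : xstar = Aᵀ.mulVec b)
    (D : Fin n → ℝ)
    -- each diagonal entry of `D` is either `0` or `1/√(l_i)` for the leverage score `l_i`
    (hD : ∀ i : Fin n, D i = 0 ∨ D i = 1 / Real.sqrt (∑ j, A i j ^ 2))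
    -- all of the top `d` rows are kept
    (hDtop : ∀ i : Fin n, (i : ℕ) < d → D i ≠ 0)
    (j : ℕ) (hjβ : j < β)
    -- the row `d + j` is dropped
    (hDdrop : ∀ i : Fin n, (i : ℕ) = d + j → D i = 0)
    (t : ℕ)
    (ht : t = (@Finset.filter (Fin n)
      (fun i => (∃ c, 1 ≤ c ∧ c ≤ L ∧ (i : ℕ) = c * d + j) ∧ D i ≠ 0)
      (fun _ => Classical.propDecidable _) Finset.univ).card) :
    -- `A` has orthonormal columns and the stated leverage scores
    Aᵀ * A = 1 ∧
    (∀ i : Fin n, (∑ j', A i j' ^ 2) =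
      if (i : ℕ) < d then 1 / (d : ℝ) else 1 / ((α : ℝ) * d)) ∧
    -- the least-squares solution and its properties
    (∀ jj : Fin d, xstar jj =
      if (jj : ℕ) < β then 1 / (d : ℝ) + 1 / Real.sqrt ((α : ℝ) * β * d) else 1 / (d : ℝ)) ∧
    vnorm (A.mulVec xstar - b) ≤ Real.sqrt 2 ∧ vnorm b = Real.sqrt 2 ∧
    -- the sketched problem has a unique minimizer
    (∃! x' : Fin d → ℝ, ∀ z : Fin d → ℝ,
      vnorm ((Matrix.diagonal D * A).mulVec x' - (Matrix.diagonal D).mulVec b) ≤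
        vnorm ((Matrix.diagonal D * A).mulVec z - (Matrix.diagonal D).mulVec b)) ∧
    -- and it satisfies `x'_j = 1/(1+t)`, hence the ℓ∞ lower bound
    (∀ x' : Fin d → ℝ,
      (∀ z : Fin d → ℝ,
        vnorm ((Matrix.diagonal D * A).mulVec x' - (Matrix.diagonal D).mulVec b) ≤
          vnorm ((Matrix.diagonal D * A).mulVec z - (Matrix.diagonal D).mulVec b)) →
      x' ⟨j, hjβ.trans hβd⟩ = 1 / (1 + (t : ℝ)) ∧
      1 / (1 + (t : ℝ)) - 1 / (d : ℝ) - 1 / Real.sqrt ((α : ℝ) * β * d) ≤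
        vnormInf (x' - xstar)) := by
  have hd0 : 0 < d := by lia
  have hdR : (0 : ℝ) < d := by exact_mod_cast hd0
  have hαR : (0 : ℝ) < α := by exact_mod_cast hα
  have hβR : (0 : ℝ) < β := by exact_mod_cast hβ₁
  have hL1 : 1 ≤ L := by
    rw [hL]
    exact Nat.mul_pos hα (by lia)
  have hLR : (L : ℝ) = α * (d - 1) := by
    rw [hL, Nat.cast_mul, Nat.cast_sub (by lia), Nat.cast_one]
  have h2d : d + d ≤ n := by
    have := Nat.mul_le_mul_right d hL1
    lia
  let col : Fin n → Fin d := fun i => ⟨i % d, Nat.mod_lt _ hd0⟩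
  let a : ℕ → ℝ := fun i => if i < d then 1 / Real.sqrt d else 1 / Real.sqrt ((α : ℝ) * d)
  let b₀ : ℕ → ℝ := fun i => if i < d then 1 / Real.sqrt d
    else if i < d + β then 1 / Real.sqrt β else 0
  have hb' : ∀ i, b i = b₀ i := fun i => by rw [hb]
  have hcol : ∀ (i : Fin n) (k : Fin d), col i = k ↔ (i : ℕ) % d = k := fun i k => Fin.ext_iff
  have hA' : ∀ i k, A i k = if col i = k then a i else 0 := fun i k => by
    simp only [hA, hcol, of_apply, a]
  have ha_pos : ∀ i, 0 < a i := fun i => by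
    simp only [a]
    split_ifs <;> positivity
  have ha_sq : ∀ i, a i ^ 2 = if i < d then 1 / (d : ℝ) else 1 / ((α : ℝ) * d) := fun i => by
    simp only [a]
    split_ifs
    · rw [div_pow, Real.sq_sqrt hdR.le, one_pow]
    · rw [div_pow, Real.sq_sqrt (by positivity), one_pow]
  have hrow : ∀ i, ∑ k, A i k ^ 2 = a i ^ 2 := fun i => by
    simp [hA']
  have hD' : ∀ i, D i ≠ 0 → D i * a i = 1 := fun i hi => by
    rw [(hD i).resolve_left hi, hrow, Real.sqrt_sq (ha_pos _).le]
    exact one_div_mul_cancel (ha_pos _).ne'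
  have hmul : ∀ x i, (A *ᵥ x) i = a i * x (col i) := fun x i => by
    simp [mulVec, dotProduct, hA']
  have hblock : ∀ c (k : Fin d), ¬ (c + 1) * d + k < d := fun c k => by
    rw [add_mul]
    lia
  have hcolsum : ∀ k : Fin d, ∑ i, (if col i = k then a i ^ 2 else 0) = 1 := fun k => by
    simp only [hcol]
    rw [sum_fin_mod_eq k.2 L hn fun i => a i ^ 2, Finset.sum_range_succ']
    simp only [ha_sq, hblock, zero_mul, zero_add, k.2, if_true, if_false, Finset.sum_const,
      Finset.card_range, nsmul_eq_mul, hLR]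
    field_simp
    ring
  have hxs : ∀ k, xstar k = ∑ i, if col i = k then a i * b i else 0 := fun k => by
    simp [hxstar, mulVec, dotProduct, hA', ite_mul]
  have hxs' : ∀ k : Fin d, xstar k =
      if (k : ℕ) < β then 1 / (d : ℝ) + 1 / Real.sqrt ((α : ℝ) * β * d) else 1 / (d : ℝ) :=
    fun k => by
    have h0 : a k * b₀ k = 1 / d := by
      simp only [a, b₀, k.2, if_true]
      rw [div_mul_div_comm, Real.mul_self_sqrt hdR.le, one_mul]
    have h1 : a (d + k) * b₀ (d + k) =
        if (k : ℕ) < β then 1 / Real.sqrt ((α : ℝ) * β * d) else 0 := by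
      simp only [a, b₀, add_lt_add_iff_left, show ¬ d + (k : ℕ) < d by lia, if_false]
      split_ifs
      · rw [div_mul_div_comm, ← Real.sqrt_mul (by positivity), one_mul, mul_right_comm]
      · simp
    have h2 : ∀ c ∈ Finset.range L, c ≠ 0 →
        a ((c + 1) * d + k) * b₀ ((c + 1) * d + k) = 0 := fun c _ hc => by
      have : 1 * d ≤ c * d := Nat.mul_le_mul_right d (Nat.pos_of_ne_zero hc)
      simp only [b₀, hblock, if_false]
      rw [if_neg (by rw [add_mul]; lia), mul_zero]
    rw [hxs]
    simp only [hcol, hb']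
    rw [sum_fin_mod_eq k.2 L hn fun i => a i * b₀ i, Finset.sum_range_succ',
      Finset.sum_eq_single_of_mem 0 (Finset.mem_range.2 hL1) h2]
    simp only [zero_add, one_mul, zero_mul, h0, h1]
    split_ifs <;> ring
  have hbsq : ∑ i, b i ^ 2 = 2 := by
    simp only [hb']
    obtain ⟨r, hr⟩ : ∃ r, n = d + (β + r) := ⟨n - d - β, by lia⟩
    rw [Fin.sum_univ_eq_sum_range (fun i => b₀ i ^ 2), hr, Finset.sum_range_add,
      Finset.sum_range_add]
    have e1 : ∑ i ∈ Finset.range d, b₀ i ^ 2 = 1 := by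
      rw [Finset.sum_congr rfl fun i hi => show b₀ i ^ 2 = 1 / (d : ℝ) by
        simp only [b₀, Finset.mem_range.1 hi, if_true]
        rw [div_pow, Real.sq_sqrt hdR.le, one_pow]]
      simp [hdR.ne']
    have e2 : ∑ i ∈ Finset.range β, b₀ (d + i) ^ 2 = 1 := by
      rw [Finset.sum_congr rfl fun i hi => show b₀ (d + i) ^ 2 = 1 / (β : ℝ) by
        simp only [b₀, add_lt_add_iff_left, Finset.mem_range.1 hi, if_true,
          show ¬ d + i < d by lia, if_false]
        rw [div_pow, Real.sq_sqrt hβR.le, one_pow]]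
      simp [hβR.ne']
    have e3 : ∀ i, b₀ (d + (β + i)) = 0 := fun i => by
      simp only [b₀, show ¬ d + (β + i) < d by lia, show ¬ d + (β + i) < d + β by lia, if_false]
    simp only [e1, e2, e3]
    norm_num
  let w : Fin n → ℝ := fun i => if D i = 0 then 0 else 1
  have hDw : ∀ i, D i * a i = w i := fun i => by
    by_cases h : D i = 0
    · simp [w, h]
    · simp [w, h, hD' i h]
  have hres : ∀ z i, ((diagonal D * A) *ᵥ z - diagonal D *ᵥ b) i =
      w i * z (col i) - D i * b i := fun z i => by
    rw [Pi.sub_apply, ← mulVec_mulVec, mulVec_diagonal, mulVec_diagonal, hmul, ← mul_assoc, hDw]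
  let W : Fin d → ℝ := fun k => ∑ i, if col i = k then w i ^ 2 else 0
  have hW : ∀ k, 0 < W k := fun k => by
    refine Finset.sum_pos' (fun i _ => by split_ifs <;> positivity)
      ⟨⟨k, by lia⟩, Finset.mem_univ _, ?_⟩
    rw [if_pos ((hcol _ _).2 (Nat.mod_eq_of_lt k.2))]
    simp [w, hDtop ⟨k, by lia⟩ k.2]
  let p : Fin d → ℝ := fun k => (∑ i, if col i = k then w i * (D i * b i) else 0) / W k
  have hpyth := sum_sq_residual_eq col w (fun i => D i * b i) p
    fun k => div_mul_cancel₀ _ (hW k).ne'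
  have hmin : ∀ x : Fin d → ℝ, (∀ z : Fin d → ℝ,
      vnorm ((diagonal D * A) *ᵥ x - diagonal D *ᵥ b) ≤
        vnorm ((diagonal D * A) *ᵥ z - diagonal D *ᵥ b)) ↔ x = p := fun x => by
    simp only [vnorm_le_vnorm_iff, hres]
    constructor
    · intro h
      have h' := h p
      rw [hpyth x, add_le_iff_nonpos_right] at h'
      have hnn : ∀ k ∈ Finset.univ, 0 ≤ W k * (x k - p k) ^ 2 :=
        fun k _ => mul_nonneg (hW k).le (sq_nonneg _)
      funext k
      have := (Finset.sum_eq_zero_iff_of_nonneg hnn).1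
        (le_antisymm h' (Finset.sum_nonneg hnn)) k (Finset.mem_univ _)
      exact sub_eq_zero.1 (pow_eq_zero_iff two_ne_zero |>.1
        ((mul_eq_zero.1 this).resolve_left (hW k).ne'))
    · rintro rfl z
      rw [hpyth z, le_add_iff_nonneg_right]
      exact Finset.sum_nonneg fun k _ => mul_nonneg (hW k).le (sq_nonneg _)
  have hpj : p ⟨j, hjβ.trans hβd⟩ = 1 / (1 + (t : ℝ)) := by
    have hjd : j < d := hjβ.trans hβd
    have hj0 : D ⟨j, by lia⟩ ≠ 0 := hDtop ⟨j, by lia⟩ hjd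
    have hnum : (∑ i, if col i = ⟨j, hjd⟩ then w i * (D i * b i) else 0) = 1 := by
      rw [Finset.sum_eq_single_of_mem ⟨j, by lia⟩ (Finset.mem_univ _)]
      · have hba : b ⟨j, by lia⟩ = a j := by
          simp only [hb', a, b₀, hjd, if_true]
        rw [if_pos ((hcol _ _).2 (Nat.mod_eq_of_lt hjd)), hba, hD' _ hj0]
        simp [w, hj0]
      · intro i _ hi
        rw [ite_eq_right_iff, hcol]
        intro hij
        change (i : ℕ) % d = j at hij
        have hdiv := Nat.mod_add_div (i : ℕ) d
        have hi0 : ¬ (i : ℕ) < d := fun h => hi (Fin.ext (by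
          rw [Nat.mod_eq_of_lt h] at hij
          exact hij))
        by_cases h1 : (i : ℕ) = d + j
        · simp [hDdrop i h1]
        · have : ¬ (i : ℕ) < d + β := fun h => h1 (by
            have := Nat.mod_eq_sub_mod (not_lt.1 hi0)
            rw [Nat.mod_eq_of_lt (show (i : ℕ) - d < d by lia)] at this
            lia)
          simp [hb', b₀, hi0, this]
    have hden : W ⟨j, hjd⟩ = 1 + t := by
      classical
      have hpt : ∀ i : Fin n, (if col i = ⟨j, hjd⟩ then w i ^ 2 else 0) =
          (if i = ⟨j, by lia⟩ then (1 : ℝ) else 0) +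
          if (∃ c, 1 ≤ c ∧ c ≤ L ∧ (i : ℕ) = c * d + j) ∧ D i ≠ 0 then 1 else 0 := fun i => by
        rw [exists_eq_mul_add_iff hjd (hn ▸ i.2)]
        simp only [hcol]
        by_cases hi : i = ⟨j, by lia⟩
        · subst hi
          simp [w, hj0, Nat.mod_eq_of_lt hjd]
        · have hij : (i : ℕ) ≠ j := fun h => hi (Fin.ext h)
          rw [if_neg hi, zero_add]
          by_cases h1 : (i : ℕ) % d = j <;> by_cases h2 : D i = 0 <;> simp [w, hij, h1, h2]
      simp only [W, hpt, Finset.sum_add_distrib, Finset.sum_boole, ht]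
      congr 1
      · rw [Finset.card_eq_one.2 ⟨⟨j, by lia⟩, by ext; simp⟩, Nat.cast_one]
      · congr!
    simp only [p]
    rw [hnum, hden]
  refine ⟨?_, fun i => (hrow i).trans (ha_sq i), hxs', ?_, ?_,
    ⟨p, (hmin p).2 rfl, fun y hy => (hmin y).1 hy⟩, ?_⟩
  · ext k l
    rw [mul_apply, one_apply]
    simp only [transpose_apply, hA']
    by_cases hkl : k = l
    · subst hkl
      rw [if_pos rfl, ← hcolsum k]
      refine Finset.sum_congr rfl fun i _ => ?_
      split_ifs <;> ring
    · rw [if_neg hkl]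
      refine Finset.sum_eq_zero fun i _ => ?_
      by_cases h : col i = k
      · rw [if_neg (fun h' => hkl (h.symm.trans h')), mul_zero]
      · rw [if_neg h, zero_mul]
  · refine Real.sqrt_le_sqrt ?_
    have h := sum_sq_residual_eq col (fun i => a i) b xstar
      (fun k => by rw [hcolsum, mul_one, hxs]) 0
    simp only [Pi.zero_apply, mul_zero, zero_sub, neg_sq, hbsq, hcolsum, one_mul] at h
    simp only [Pi.sub_apply, hmul]
    rw [h]
    exact le_add_of_nonneg_right (Finset.sum_nonneg fun _ _ => sq_nonneg _)
  · rw [vnorm, hbsq]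
  · intro x' hx'
    obtain rfl := (hmin x').1 hx'
    refine ⟨hpj, le_trans ?_ (le_ciSup (Set.finite_range _).bddAbove ⟨j, hjβ.trans hβd⟩)⟩
    refine le_trans (le_of_eq ?_) (le_abs_self _)
    rw [Pi.sub_apply, hpj, hxs', if_pos hjβ]
    ring
end
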